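/- Let H be a complex Hilbert space and let π : 𝔐 → B(H) be a continuous unital star-algebra homomorphism that is irreducible, i.e. the only closed subspaces of H invariant under π(x) for every x ∈ 𝔐 are {0} and H. If there exists a nonzero vector ξ ∈ H with π(a_i a_i†) ξ = ξ for every integer i (equivalently, the strong limit of the decreasing sequence of projections π(a_i a_i†) as i → +∞ is nonzero), then π is unitarily equivalent to the Fock (identity) representation: there exists a unitary U : F → H such that π(x) ∘ U = U ∘ x for every x ∈ 𝔐. -/

import Mathlib

noncomputable section

open ContinuousLinearMap
open scoped InnerProductSpace ComplexOrder

/-- The discrete monotone Fock space: `ℓ²` over the finite subsets of `ℤ`. -/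
abbrev MF : Type := lp (fun _ : Finset ℤ => ℂ) 2

/-- The canonical orthonormal basis vector corresponding to a finite subset `S ⊆ ℤ`;
`eS ∅` is the vacuum vector `Ω`. -/
noncomputable def eS (S : Finset ℤ) : MF := lp.single 2 S 1

/-- `a : ℤ → MF →L[ℂ] MF` is the family of monotone annihilation operators:
`a i (eS S) = eS (S \ {i})` if `S` is nonempty with `min S = i`, and `a i (eS S) = 0`
otherwise.  The creation operator `a_i†` is the Hilbert-space adjoint of `a i`. -/
def IsMonotoneAnnihilation (a : ℤ → MF →L[ℂ] MF) : Prop :=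
  ∀ (i : ℤ) (S : Finset ℤ),
    (S.min = (i : WithBot ℤ) → a i (eS S) = eS (S.erase i)) ∧
    (S.min ≠ (i : WithBot ℤ) → a i (eS S) = 0)

/-- The monotone C*-algebra `𝔐`: the unital C*-subalgebra of `B(F)` generated by the
annihilation operators. -/
noncomputable def MonM (a : ℤ → MF →L[ℂ] MF) : StarSubalgebra ℂ (MF →L[ℂ] MF) :=
  (StarAlgebra.adjoin ℂ (Set.range a)).topologicalClosure

lemma a_mem_MonM (a : ℤ → MF →L[ℂ] MF) (i : ℤ) : a i ∈ MonM a :=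
  StarSubalgebra.le_topologicalClosure _ (StarAlgebra.subset_adjoin ℂ _ ⟨i, rfl⟩)

lemma aad_mem_MonM (a : ℤ → MF →L[ℂ] MF) (i : ℤ) :
    (a i).comp (adjoint (a i)) ∈ MonM a := by
  have h := mul_mem (a_mem_MonM a i) (star_mem (a_mem_MonM a i))
  rwa [star_eq_adjoint, mul_def] at h

lemma ada_mem_MonM (a : ℤ → MF →L[ℂ] MF) (i : ℤ) :
    (adjoint (a i)).comp (a i) ∈ MonM a := by
  have h := mul_mem (star_mem (a_mem_MonM a i)) (a_mem_MonM a i)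
  rwa [star_eq_adjoint, mul_def] at h

lemma hasSum_coord_smul_eS (v : MF) : HasSum (fun S => v S • eS S) v := by
  have h := lp.hasSum_single (p := 2) (by norm_num) v
  convert h using 2 with S
  rw [eS, ← lp.single_smul]
  simp

lemma continuousLinearMap_ext_eS {E : Type*} [NormedAddCommGroup E] [NormedSpace ℂ E]
    {A B : MF →L[ℂ] E} (h : ∀ S, A (eS S) = B (eS S)) : A = B := by
  ext v
  refine ((hasSum_coord_smul_eS v).mapL A).unique ?_
  simpa [h] using (hasSum_coord_smul_eS v).mapL B

lemma inner_eS_left (S : Finset ℤ) (v : MF) : ⟪eS S, v⟫_ℂ = v S := by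
  rw [eS, lp.inner_single_left]
  simp

lemma eS_apply (S T : Finset ℤ) : (eS S : MF) T = if T = S then 1 else 0 := by
  by_cases h : T = S
  · subst h; simp [eS]
  · simp [eS, h, lp.single_apply]

lemma inner_eS_eS (S T : Finset ℤ) : ⟪eS S, eS T⟫_ℂ = if S = T then 1 else 0 := by
  rw [inner_eS_left, eS_apply]

lemma min_eq_coe_iff {S : Finset ℤ} {i : ℤ} :
    S.min = (i : WithTop ℤ) ↔ i ∈ S ∧ ∀ j ∈ S, i ≤ j := by
  constructor
  · intro h
    exact ⟨Finset.mem_of_min h, fun j hj => Finset.min_le_of_eq hj h⟩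
  · rintro ⟨hi, h⟩
    exact le_antisymm (Finset.min_le hi) (Finset.le_min fun j hj => WithTop.coe_le_coe.2 (h j hj))

/-- The relations satisfied by the monotone annihilation operators, together with a vacuum
vector of norm one. -/
structure IsMonotoneVacuum {H : Type*} [NormedAddCommGroup H] [InnerProductSpace ℂ H]
    [CompleteSpace H] (A : ℤ → H →L[ℂ] H) (ξ : H) : Prop where
  ann_cre_of_ne : ∀ i j, i ≠ j → A i * star (A j) = 0
  ann_ann_of_le : ∀ i j, i ≤ j → A i * A j = 0
  ann_cre_cre_of_lt : ∀ i j, i < j → A i * star (A i) * star (A j) = star (A j)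
  ann_cre_vacuum : ∀ i, A i (star (A i) ξ) = ξ
  norm_vacuum : ‖ξ‖ = 1

/-- The vector obtained by applying the creation operators indexed by `S` to `ξ`, the one of
smallest index last. -/
def creationVector {H : Type*} [NormedAddCommGroup H] [InnerProductSpace ℂ H]
    [CompleteSpace H] (A : ℤ → H →L[ℂ] H) (ξ : H) (S : Finset ℤ) : H :=
  (S.sort (· ≤ ·)).foldr (fun i v => star (A i) v) ξ

namespace IsMonotoneVacuum

variable {H : Type*} [NormedAddCommGroup H] [InnerProductSpace ℂ H] [CompleteSpace H]
  {A : ℤ → H →L[ℂ] H} {ξ : H}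

lemma creationVector_empty : creationVector A ξ ∅ = ξ := by
  simp [creationVector]

lemma creationVector_insert {i : ℤ} {S : Finset ℤ} (h : ∀ j ∈ S, i < j) :
    creationVector A ξ (insert i S) = star (A i) (creationVector A ξ S) := by
  rw [creationVector, Finset.sort_insert _ (fun j hj => (h j hj).le)
    (fun hi => (h i hi).false)]
  rfl

lemma ann_vacuum (h : IsMonotoneVacuum A ξ) (i : ℤ) : A i ξ = 0 := by
  rw [← h.ann_cre_vacuum i, ← mul_apply_eq_comp, h.ann_ann_of_le i i le_rfl, zero_apply]

lemma ann_creationVector_insert (h : IsMonotoneVacuum A ξ) {i : ℤ} {S : Finset ℤ}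
    (hS : ∀ j ∈ S, i < j) :
    A i (creationVector A ξ (insert i S)) = creationVector A ξ S := by
  rw [creationVector_insert hS]
  induction S using Finset.induction_on_min with
  | empty => rw [creationVector_empty, h.ann_cre_vacuum]
  | insert j T hT _ =>
    rw [creationVector_insert hT, ← mul_apply_eq_comp, ← mul_apply_eq_comp,
      h.ann_cre_cre_of_lt i j (hS j (Finset.mem_insert_self j T))]

lemma ann_creationVector_of_min_ne (h : IsMonotoneVacuum A ξ) {i : ℤ} {S : Finset ℤ}
    (hS : S.min ≠ (i : WithTop ℤ)) : A i (creationVector A ξ S) = 0 := by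
  induction S using Finset.induction_on_min with
  | empty => rw [creationVector_empty, h.ann_vacuum]
  | insert j T hT _ =>
    have hij : i ≠ j := by
      rintro rfl
      refine hS (min_eq_coe_iff.2 ⟨Finset.mem_insert_self i T, ?_⟩)
      simpa using fun k hk => (hT k hk).le
    rw [creationVector_insert hT, ← mul_apply_eq_comp, h.ann_cre_of_ne i j hij, zero_apply]

lemma ann_creationVector (h : IsMonotoneVacuum A ξ) (i : ℤ) (S : Finset ℤ) :
    A i (creationVector A ξ S) =
      if S.min = (i : WithTop ℤ) then creationVector A ξ (S.erase i) else 0 := by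
  split_ifs with hS
  · rw [min_eq_coe_iff] at hS
    conv_lhs => rw [← Finset.insert_erase hS.1]
    refine h.ann_creationVector_insert fun j hj => ?_
    exact lt_of_le_of_ne (hS.2 j (Finset.mem_of_mem_erase hj)) (Finset.ne_of_mem_erase hj).symm
  · exact h.ann_creationVector_of_min_ne hS

lemma cre_creationVector (h : IsMonotoneVacuum A ξ) (i : ℤ) (S : Finset ℤ) :
    star (A i) (creationVector A ξ S) =
      if ∀ j ∈ S, i < j then creationVector A ξ (insert i S) else 0 := by
  split_ifs with hS
  · rw [creationVector_insert hS]
  · induction S using Finset.induction_on_min with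
    | empty => simp at hS
    | insert j T hT _ =>
      have hji : j ≤ i := by
        by_contra! hij
        exact hS (by simpa [hij] using fun k hk => hij.trans (hT k hk))
      rw [creationVector_insert hT, ← mul_apply_eq_comp, ← star_mul, h.ann_ann_of_le j i hji, star_zero,
        zero_apply]

lemma inner_creationVector (h : IsMonotoneVacuum A ξ) (S T : Finset ℤ) :
    ⟪creationVector A ξ S, creationVector A ξ T⟫_ℂ = if S = T then 1 else 0 := by
  induction S using Finset.induction_on_min generalizing T with
  | empty =>
    induction T using Finset.induction_on_min with
    | empty => simp [creationVector_empty, h.norm_vacuum]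
    | insert i T hT _ =>
      rw [creationVector_insert hT, star_eq_adjoint, adjoint_inner_right, creationVector_empty,
        h.ann_vacuum, inner_zero_left, if_neg (Finset.insert_ne_empty i T).symm]
  | insert i S hS ih =>
    rw [creationVector_insert hS, star_eq_adjoint, adjoint_inner_left, h.ann_creationVector]
    have hiS : i ∉ S := fun hi => (hS i hi).false
    split_ifs with hT hST hST
    · rw [ih, if_pos]
      rw [← hST, Finset.erase_insert hiS]
    · rw [ih, if_neg]
      rintro rfl
      exact hST (Finset.insert_erase (min_eq_coe_iff.1 hT).1)
    · refine absurd (min_eq_coe_iff.2 ?_) hT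
      subst hST
      exact ⟨Finset.mem_insert_self i S, by simpa using fun k hk => (hS k hk).le⟩
    · exact inner_zero_right _

lemma orthonormal_creationVector (h : IsMonotoneVacuum A ξ) :
    Orthonormal ℂ (creationVector A ξ) :=
  orthonormal_iff_ite.2 h.inner_creationVector

/-- The isometry from the monotone Fock space sending `eS S` to `creationVector A ξ S`. -/
def fockIsometry (h : IsMonotoneVacuum A ξ) : MF →ₗᵢ[ℂ] H :=
  h.orthonormal_creationVector.orthogonalFamily.linearIsometry

lemma fockIsometry_eS (h : IsMonotoneVacuum A ξ) (S : Finset ℤ) :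
    h.fockIsometry (eS S) = creationVector A ξ S := by
  rw [fockIsometry, eS, OrthogonalFamily.linearIsometry_apply_single]
  simp

end IsMonotoneVacuum

namespace IsMonotoneAnnihilation

variable {a : ℤ → MF →L[ℂ] MF}

lemma ann_eS (ha : IsMonotoneAnnihilation a) (i : ℤ) (S : Finset ℤ) :
    a i (eS S) = if S.min = (i : WithTop ℤ) then eS (S.erase i) else 0 := by
  split_ifs with h
  · exact (ha i S).1 h
  · exact (ha i S).2 h

lemma cre_eS (ha : IsMonotoneAnnihilation a) (i : ℤ) (S : Finset ℤ) :
    star (a i) (eS S) = if ∀ j ∈ S, i < j then eS (insert i S) else 0 := by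
  ext T
  rw [← inner_eS_left, star_eq_adjoint, adjoint_inner_right, ha.ann_eS]
  have key : (T.min = (i : WithTop ℤ) ∧ T.erase i = S) ↔
      ((∀ j ∈ S, i < j) ∧ T = insert i S) := by
    rw [min_eq_coe_iff]
    constructor
    · rintro ⟨⟨hi, hT⟩, rfl⟩
      refine ⟨fun j hj => ?_, (Finset.insert_erase hi).symm⟩
      exact lt_of_le_of_ne (hT j (Finset.mem_of_mem_erase hj)) (Finset.ne_of_mem_erase hj).symm
    · rintro ⟨hS, rfl⟩
      have hiS : i ∉ S := fun hi => (hS i hi).false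
      refine ⟨⟨Finset.mem_insert_self i S, ?_⟩, Finset.erase_insert hiS⟩
      simpa using fun k hk => (hS k hk).le
  by_cases h₁ : T.min = (i : WithTop ℤ) <;> by_cases h₂ : ∀ j ∈ S, i < j
  · rw [if_pos h₁, if_pos h₂, inner_eS_eS, eS_apply]
    simp only [h₁, true_and, eq_true h₂] at key
    simp only [key]
  · rw [if_pos h₁, if_neg h₂, inner_eS_eS]
    simp only [h₁, true_and, h₂, false_and, iff_false] at key
    simp [key]
  · rw [if_neg h₁, if_pos h₂, eS_apply]
    simp only [h₁, true_and, eq_true h₂, false_and, false_iff] at key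
    simp [key]
  · rw [if_neg h₁, if_neg h₂]
    simp

lemma ann_mul_cre_of_ne (ha : IsMonotoneAnnihilation a) {i j : ℤ} (hij : i ≠ j) :
    a i * star (a j) = 0 := by
  refine continuousLinearMap_ext_eS fun S => ?_
  rw [mul_apply_eq_comp, ha.cre_eS, zero_apply]
  split_ifs with hS
  · rw [ha.ann_eS, if_neg]
    rw [min_eq_coe_iff]
    rintro ⟨hi, h⟩
    have hi' := (Finset.mem_insert.1 hi).resolve_left hij
    exact absurd (h j (Finset.mem_insert_self j S)) (hS i hi').not_ge
  · exact map_zero _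

lemma ann_mul_ann_of_le (ha : IsMonotoneAnnihilation a) {i j : ℤ} (hij : i ≤ j) :
    a i * a j = 0 := by
  refine continuousLinearMap_ext_eS fun S => ?_
  rw [mul_apply_eq_comp, ha.ann_eS, zero_apply]
  split_ifs with hS
  · rw [ha.ann_eS, if_neg]
    rw [min_eq_coe_iff] at hS ⊢
    rintro ⟨hi, -⟩
    have := hS.2 i (Finset.mem_of_mem_erase hi)
    exact Finset.ne_of_mem_erase hi (le_antisymm hij this)
  · exact map_zero _

lemma ann_mul_cre_mul_cre_of_lt (ha : IsMonotoneAnnihilation a) {i j : ℤ} (hij : i < j) :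
    a i * star (a i) * star (a j) = star (a j) := by
  refine continuousLinearMap_ext_eS fun S => ?_
  rw [mul_apply_eq_comp, mul_apply_eq_comp, ha.cre_eS]
  split_ifs with hS
  · have hi : ∀ k ∈ insert j S, i < k := by
      simpa [hij] using fun k hk => hij.trans (hS k hk)
    rw [ha.cre_eS, if_pos hi, ha.ann_eS, if_pos, Finset.erase_insert fun h => (hi i h).false]
    rw [min_eq_coe_iff]
    exact ⟨Finset.mem_insert_self _ _, fun k hk => (Finset.mem_insert.1 hk).elim
      (fun h => h.ge) fun h => (hi k h).le⟩
  · simp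

end IsMonotoneAnnihilation

/-- A closed condition on elements of the monotone C*-algebra that holds for the generators and
is preserved by the algebra operations holds everywhere. -/
lemma MonM_induction {a : ℤ → MF →L[ℂ] MF} {p : MonM a → Prop}
    (closed : IsClosed {x | p x}) (ann : ∀ i, p ⟨a i, a_mem_MonM a i⟩)
    (algebraMap : ∀ r, p (algebraMap ℂ _ r)) (add : ∀ x y, p x → p y → p (x + y))
    (mul : ∀ x y, p x → p y → p (x * y)) (star : ∀ x, p x → p (star x)) (x : MonM a) : p x := by
  have hle : StarAlgebra.adjoin ℂ (Set.range a) ≤ MonM a :=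
    StarSubalgebra.le_topologicalClosure _
  have hadj : ∀ y (hy : y ∈ StarAlgebra.adjoin ℂ (Set.range a)), p ⟨y, hle hy⟩ := by
    intro y hy
    induction hy using StarAlgebra.adjoin_induction with
    | mem z hz => obtain ⟨i, rfl⟩ := hz; exact ann i
    | algebraMap r => exact algebraMap r
    | add y z hy hz h₁ h₂ => exact add ⟨y, hle hy⟩ ⟨z, hle hz⟩ h₁ h₂
    | mul y z hy hz h₁ h₂ => exact mul ⟨y, hle hy⟩ ⟨z, hle hz⟩ h₁ h₂
    | star y hy h => exact star ⟨y, hle hy⟩ h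
  have hx : (x : MF →L[ℂ] MF) ∈
      closure (StarAlgebra.adjoin ℂ (Set.range a) : Set (MF →L[ℂ] MF)) := by
    rw [← StarSubalgebra.topologicalClosure_coe]
    exact x.2
  obtain ⟨u, hu, hux⟩ := mem_closure_iff_seq_limit.1 hx
  have hlim : Filter.Tendsto (fun n => (⟨u n, hle (hu n)⟩ : MonM a)) Filter.atTop (nhds x) :=
    tendsto_subtype_rng.2 hux
  exact closed.mem_of_tendsto hlim (Filter.Eventually.of_forall fun n => hadj (u n) (hu n))

/-- The image of the annihilation operators under a representation of the monotone C*-algebra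
satisfies the monotone relations. -/
lemma IsMonotoneAnnihilation.isMonotoneVacuum {a : ℤ → MF →L[ℂ] MF}
    (ha : IsMonotoneAnnihilation a) {H : Type*} [NormedAddCommGroup H] [InnerProductSpace ℂ H]
    [CompleteSpace H] (π : MonM a →⋆ₐ[ℂ] (H →L[ℂ] H)) {ξ : H} (hξ : ‖ξ‖ = 1)
    (h : ∀ i, π ⟨(a i).comp (adjoint (a i)), aad_mem_MonM a i⟩ ξ = ξ) :
    IsMonotoneVacuum (fun i => π ⟨a i, a_mem_MonM a i⟩) ξ where
  ann_cre_of_ne i j hij := by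
    rw [← map_star, ← map_mul, ← map_zero π]
    exact congrArg π (Subtype.ext (ha.ann_mul_cre_of_ne hij))
  ann_ann_of_le i j hij := by
    rw [← map_mul, ← map_zero π]
    exact congrArg π (Subtype.ext (ha.ann_mul_ann_of_le hij))
  ann_cre_cre_of_lt i j hij := by
    simp only [← map_star, ← map_mul]
    exact congrArg π (Subtype.ext (ha.ann_mul_cre_mul_cre_of_lt hij))
  ann_cre_vacuum i := by
    rw [← mul_apply_eq_comp, ← map_star, ← map_mul]
    exact h i
  norm_vacuum := hξ

/-- The isometry associated with a vacuum vector intertwines the identity representation with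
the given one. -/
lemma fockIsometry_intertwines {a : ℤ → MF →L[ℂ] MF} (ha : IsMonotoneAnnihilation a)
    {H : Type*} [NormedAddCommGroup H] [InnerProductSpace ℂ H] [CompleteSpace H]
    {π : MonM a →⋆ₐ[ℂ] (H →L[ℂ] H)} (hπ : Continuous π) {ξ : H}
    (h : IsMonotoneVacuum (fun i => π ⟨a i, a_mem_MonM a i⟩) ξ) (x : MonM a) (v : MF) :
    π x (h.fockIsometry v) = h.fockIsometry ((x : MF →L[ℂ] MF) v) := by
  let V : MF →L[ℂ] H := h.fockIsometry.toContinuousLinearMap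
  suffices hx : (π x ∘L V = V ∘L (x : MF →L[ℂ] MF)) ∧
      (π (star x) ∘L V = V ∘L ((star x : MonM a) : MF →L[ℂ] MF)) from
    DFunLike.congr_fun hx.1 v
  induction x using MonM_induction with
  | closed =>
    refine IsClosed.inter (isClosed_eq ?_ ?_) (isClosed_eq ?_ ?_) <;> fun_prop
  | ann i =>
    constructor
    · refine continuousLinearMap_ext_eS fun S => ?_
      change π ⟨a i, a_mem_MonM a i⟩ (h.fockIsometry (eS S)) = h.fockIsometry (a i (eS S))
      rw [h.fockIsometry_eS, h.ann_creationVector i S, ha.ann_eS, apply_ite h.fockIsometry,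
        h.fockIsometry_eS, map_zero]
    · refine continuousLinearMap_ext_eS fun S => ?_
      rw [map_star]
      change star (π ⟨a i, a_mem_MonM a i⟩) (h.fockIsometry (eS S)) =
        h.fockIsometry (star (a i) (eS S))
      rw [h.fockIsometry_eS, h.cre_creationVector i S, ha.cre_eS, apply_ite h.fockIsometry,
        h.fockIsometry_eS, map_zero]
  | algebraMap r =>
    have hr : ∀ r : ℂ, π (algebraMap ℂ _ r) ∘L V =
        V ∘L ((algebraMap ℂ (MonM a) r : MonM a) : MF →L[ℂ] MF) := by
      intro r
      rw [AlgHomClass.commutes]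
      ext v
      exact (map_smul V r v).symm
    exact ⟨hr r, by rw [← algebraMap_star_comm]; exact hr _⟩
  | add x y hx hy =>
    simp only [star_add, map_add, add_comp, hx, hy, StarMemClass.coe_star, AddMemClass.coe_add,
      comp_add, and_self]
  | mul x y hx hy =>
    have hmul : ∀ x y : MonM a, π x ∘L V = V ∘L (x : MF →L[ℂ] MF) →
        π y ∘L V = V ∘L (y : MF →L[ℂ] MF) →
        π (x * y) ∘L V = V ∘L ((x * y : MonM a) : MF →L[ℂ] MF) := by
      intro x y hx hy
      rw [map_mul, mul_def, comp_assoc, hy, ← comp_assoc, hx, comp_assoc]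
      rfl
    exact ⟨hmul x y hx.1 hy.1, by rw [star_mul]; exact hmul _ _ hy.2 hx.2⟩
  | star x hx => exact ⟨hx.2, by rw [star_star]; exact hx.1⟩

/-- Any irreducible representation `π` of `𝔐` admitting a nonzero vector `ξ` with
`π(a_i a_i†) ξ = ξ` for all `i` is unitarily equivalent to the Fock representation. -/
theorem stmt9 (a : ℤ → MF →L[ℂ] MF) (ha : IsMonotoneAnnihilation a)
    (H : Type) [NormedAddCommGroup H] [InnerProductSpace ℂ H] [CompleteSpace H]
    (π : ↥(MonM a) →⋆ₐ[ℂ] (H →L[ℂ] H)) (hπcont : Continuous π)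
    (hirr : ∀ K : Submodule ℂ H, IsClosed (K : Set H) →
      (∀ x : ↥(MonM a), ∀ v ∈ K, π x v ∈ K) → K = ⊥ ∨ K = ⊤)
    (hξ : ∃ ξ : H, ξ ≠ 0 ∧
      ∀ i : ℤ, π ⟨(a i).comp (adjoint (a i)), aad_mem_MonM a i⟩ ξ = ξ) :
    ∃ U : MF ≃ₗᵢ[ℂ] H, ∀ (x : ↥(MonM a)) (v : MF),
      π x (U v) = U ((x : MF →L[ℂ] MF) v) := by
  obtain ⟨ξ, hξ₀, hξ⟩ := hξ
  have h := ha.isMonotoneVacuum π (ξ := (‖ξ‖⁻¹ : ℂ) • ξ)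
    (by simpa using norm_smul_inv_norm (𝕜 := ℂ) hξ₀) (fun i => by rw [map_smul, hξ i])
  have hV := fockIsometry_intertwines ha hπcont h
  have hrange : LinearMap.range h.fockIsometry.toLinearMap = ⊤ := by
    refine (hirr _ ?_ ?_).resolve_left fun hbot => ?_
    · exact h.fockIsometry.isometry.isClosedEmbedding.isClosed_range
    · rintro x _ ⟨v, rfl⟩
      exact ⟨_, (hV x v).symm⟩
    · have h₀ : h.fockIsometry (eS ∅) = 0 :=
        (Submodule.eq_bot_iff _).1 hbot _ ⟨eS ∅, rfl⟩
      rw [h.fockIsometry_eS] at h₀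
      exact h.orthonormal_creationVector.ne_zero ∅ h₀
  exact ⟨LinearIsometryEquiv.ofSurjective h.fockIsometry (LinearMap.range_eq_top.1 hrange), hV⟩
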